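/- arXiv:2503.09497 — 4 statements merged into one kernel-verified Lean document; each statement's English description precedes it below -/
import Mathlib

section
/- For every λ > 0, μ > 0 and t ∈ ℝ, the function z ↦ f(z, μ) + (z − t)²/(2λ) has a unique minimizer over ℝ, equal to tμ/(μ + λ) if |t| ≤ μ + λ, and equal to t − λ·sign(t) if |t| > μ + λ. -/
/-- Huber smoothing function: f(z, μ) = |z| if |z| ≥ μ, and z²/(2μ) + μ/2 if |z| < μ. -/
noncomputable def huber (μ z : ℝ) : ℝ :=
  if μ ≤ |z| then |z| else z ^ 2 / (2 * μ) + μ / 2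

/-- The claimed proximal point of the Huber function. -/
noncomputable def huberProx (μ lam t : ℝ) : ℝ :=
  if |t| ≤ μ + lam then t * μ / (μ + lam) else t - lam * Real.sign t

/-- Affine minorants of the Huber function, one for each slope in `[-1, 1]`. -/
theorem affine_le_huber {μ g : ℝ} (hμ : 0 < μ) (hg : |g| ≤ 1) (z : ℝ) :
    g * z + μ * (1 - g ^ 2) / 2 ≤ huber μ z := by
  unfold huber
  split_ifs with h
  · have h1 : g * z ≤ |g| * |z| := by
      rw [← abs_mul]
      exact le_abs_self _
    have h2 := mul_le_mul_of_nonneg_left h (sub_nonneg.2 hg)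
    have h3 := mul_nonneg hμ.le (sq_nonneg (1 - |g|))
    rw [← sq_abs g]
    nlinarith
  · have h1 : z ^ 2 / (2 * μ) + μ / 2 - (g * z + μ * (1 - g ^ 2) / 2)
        = (z - g * μ) ^ 2 / (2 * μ) := by
      field_simp
      ring
    have h2 : 0 ≤ (z - g * μ) ^ 2 / (2 * μ) := by positivity
    linarith

/-- The affine minorant of slope `(t - p) / lam` touches the Huber function at the proximal
point `p` of `t`. -/
theorem exists_slope_huberProx {μ lam : ℝ} (t : ℝ) (hμ : 0 < μ) (hlam : 0 < lam) :
    ∃ g : ℝ, |g| ≤ 1 ∧ t = huberProx μ lam t + lam * g ∧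
      huber μ (huberProx μ lam t) = g * huberProx μ lam t + μ * (1 - g ^ 2) / 2 := by
  have hs : 0 < μ + lam := add_pos hμ hlam
  by_cases ht : |t| ≤ μ + lam
  · have hg : |t / (μ + lam)| ≤ 1 := by
      rwa [abs_div, abs_of_pos hs, div_le_one hs]
    have hp : huberProx μ lam t = t / (μ + lam) * μ := by
      rw [huberProx, if_pos ht]
      ring
    have heq : t = t / (μ + lam) * μ + lam * (t / (μ + lam)) := by
      field_simp
    refine ⟨t / (μ + lam), hg, by rwa [hp], ?_⟩
    rw [hp]
    generalize t / (μ + lam) = g at hg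
    unfold huber
    split_ifs with h
    · rw [abs_mul, abs_of_pos hμ] at *
      have hg1 : |g| = 1 := le_antisymm hg (by nlinarith)
      have hsq : g ^ 2 = 1 := by rw [← sq_abs, hg1, one_pow]
      rw [hg1]
      linear_combination (-μ / 2) * hsq
    · field_simp
      ring
  · have hp : huberProx μ lam t = t - lam * Real.sign t := by
      rw [huberProx, if_neg ht]
    rw [hp]
    push Not at ht
    rcases lt_abs.1 ht with h | h
    · have hz : |t - lam * 1| = t - lam * 1 := abs_of_pos (by linarith)
      rw [Real.sign_of_pos (by linarith)]
      refine ⟨1, by simp, by ring, ?_⟩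
      rw [huber, hz, if_pos (by linarith)]
      ring
    · have hz : |t - lam * -1| = -(t - lam * -1) := abs_of_neg (by linarith)
      rw [Real.sign_of_neg (by linarith)]
      refine ⟨-1, by simp, by ring, ?_⟩
      rw [huber, hz, if_pos (by linarith)]
      ring

/-- Quadratic growth of the proximal objective around the proximal point. -/
theorem huber_objective_growth {μ lam : ℝ} (t z : ℝ) (hμ : 0 < μ) (hlam : 0 < lam) :
    huber μ (huberProx μ lam t) + (huberProx μ lam t - t) ^ 2 / (2 * lam)
      + (z - huberProx μ lam t) ^ 2 / (2 * lam) ≤ huber μ z + (z - t) ^ 2 / (2 * lam) := by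
  obtain ⟨g, hg, ht, hp⟩ := exists_slope_huberProx t hμ hlam
  have hz := affine_le_huber hμ hg z
  rw [hp]
  generalize huberProx μ lam t = p at ht
  subst ht
  have h : (z - (p + lam * g)) ^ 2 / (2 * lam) - (p - (p + lam * g)) ^ 2 / (2 * lam)
      - (z - p) ^ 2 / (2 * lam) = -(g * (z - p)) := by
    field_simp
    ring
  linarith

/-- For every λ > 0, μ > 0 and t ∈ ℝ, the function
z ↦ f(z, μ) + (z − t)²/(2λ) has a unique minimizer over ℝ, equal to tμ/(μ + λ) if
|t| ≤ μ + λ, and equal to t − λ·sign(t) if |t| > μ + λ. -/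
theorem huber_prox (μ lam t : ℝ) (hμ : 0 < μ) (hlam : 0 < lam) :
    IsMinOn (fun z : ℝ => huber μ z + (z - t) ^ 2 / (2 * lam)) Set.univ
      (huberProx μ lam t) ∧
    (∀ z : ℝ, IsMinOn (fun z : ℝ => huber μ z + (z - t) ^ 2 / (2 * lam)) Set.univ z →
      z = huberProx μ lam t) := by
  refine ⟨fun z _ => ?_, fun z hz => ?_⟩
  · have h := huber_objective_growth t z hμ hlam
    have h0 : 0 ≤ (z - huberProx μ lam t) ^ 2 / (2 * lam) := by positivity
    change huber μ (huberProx μ lam t) + (huberProx μ lam t - t) ^ 2 / (2 * lam)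
      ≤ huber μ z + (z - t) ^ 2 / (2 * lam)
    linarith
  · have h := huber_objective_growth t z hμ hlam
    have hmin : huber μ z + (z - t) ^ 2 / (2 * lam) ≤
        huber μ (huberProx μ lam t) + (huberProx μ lam t - t) ^ 2 / (2 * lam) :=
      hz (Set.mem_univ _)
    by_contra hne
    have hpos : 0 < (z - huberProx μ lam t) ^ 2 / (2 * lam) :=
      div_pos (sq_pos_of_ne_zero (sub_ne_zero.2 hne)) (by positivity)
    linarith
end

section
/- Let μ > 0 and 0 < α < μ. For every c ∈ ℝⁿ, the function z ↦ −e_φ(z, μ) + ‖z − c‖²/(2α) has a unique minimizer over ℝⁿ, equal to a + (μ/(μ − α))·(c − a) if ‖c − a‖ ≤ μ − α, and equal to a + ((‖c − a‖ + α)/‖c − a‖)·(c − a) if ‖c − a‖ > μ − α. -/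
/-- Moreau envelope of φ(x) = ‖x − a‖ − d with parameter μ. -/
noncomputable def moreauEnv (n : ℕ) (a : EuclideanSpace ℝ (Fin n)) (d μ : ℝ)
    (x : EuclideanSpace ℝ (Fin n)) : ℝ :=
  ⨅ y : EuclideanSpace ℝ (Fin n), (‖y - a‖ - d + ‖x - y‖ ^ 2 / (2 * μ))

/-- The claimed proximal point of −e_φ(·, μ) with step α at c. -/
noncomputable def proxNegMoreau (n : ℕ) (a : EuclideanSpace ℝ (Fin n)) (μ α : ℝ)
    (c : EuclideanSpace ℝ (Fin n)) : EuclideanSpace ℝ (Fin n) :=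
  if ‖c - a‖ ≤ μ - α then a + (μ / (μ - α)) • (c - a)
  else a + ((‖c - a‖ + α) / ‖c - a‖) • (c - a)

theorem moreauEnv_le (n : ℕ) (a : EuclideanSpace ℝ (Fin n)) (d : ℝ) {μ : ℝ} (hμ : 0 < μ)
    (x y : EuclideanSpace ℝ (Fin n)) :
    moreauEnv n a d μ x ≤ ‖y - a‖ - d + ‖x - y‖ ^ 2 / (2 * μ) := by
  refine ciInf_le (f := fun y => ‖y - a‖ - d + ‖x - y‖ ^ 2 / (2 * μ)) ⟨-d, ?_⟩ y
  rintro _ ⟨y, rfl⟩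
  have : 0 ≤ ‖x - y‖ ^ 2 / (2 * μ) := by positivity
  linarith [norm_nonneg (y - a)]

/-- If `p - μ • g` attains the infimum defining the envelope at `p`, then
`z ↦ -e_φ(z, μ) + ‖z - c‖² / (2α)` with `c = p - α • g` grows quadratically away from `p`. -/
theorem neg_moreauEnv_add_sq_quadratic_growth {n : ℕ} {a : EuclideanSpace ℝ (Fin n)} {d μ α : ℝ}
    (hμ : 0 < μ) (hα : 0 < α) {p g c : EuclideanSpace ℝ (Fin n)} (hc : p - c = α • g)
    (hprox : ∀ y, ‖p - μ • g - a‖ + μ * ‖g‖ ^ 2 / 2 ≤ ‖y - a‖ + ‖p - y‖ ^ 2 / (2 * μ))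
    (z : EuclideanSpace ℝ (Fin n)) :
    -moreauEnv n a d μ p + ‖p - c‖ ^ 2 / (2 * α) + (1 / α - 1 / μ) / 2 * ‖z - p‖ ^ 2 ≤
      -moreauEnv n a d μ z + ‖z - c‖ ^ 2 / (2 * α) := by
  have hp : ‖p - μ • g - a‖ + μ * ‖g‖ ^ 2 / 2 - d ≤ moreauEnv n a d μ p :=
    le_ciInf fun y => by linarith [hprox y]
  have hz := moreauEnv_le n a d hμ z (p - μ • g)
  have expand (t : ℝ) : ‖z - p + t • g‖ ^ 2 =
      ‖z - p‖ ^ 2 + 2 * t * inner ℝ (z - p) g + t ^ 2 * ‖g‖ ^ 2 := by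
    rw [norm_add_sq_real, inner_smul_right, norm_smul, mul_pow, Real.norm_eq_abs, sq_abs]
    ring
  have hzc : z - c = z - p + α • g := by rw [← hc]; abel
  have hzy : z - (p - μ • g) = z - p + μ • g := by abel
  rw [hzy, expand] at hz
  rw [hzc, expand, hc, norm_smul, mul_pow, Real.norm_eq_abs, sq_abs]
  have e₁ : (‖z - p‖ ^ 2 + 2 * μ * inner ℝ (z - p) g + μ ^ 2 * ‖g‖ ^ 2) / (2 * μ) =
      1 / μ / 2 * ‖z - p‖ ^ 2 + inner ℝ (z - p) g + μ * ‖g‖ ^ 2 / 2 := by field_simp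
  have e₂ : (‖z - p‖ ^ 2 + 2 * α * inner ℝ (z - p) g + α ^ 2 * ‖g‖ ^ 2) / (2 * α) =
      1 / α / 2 * ‖z - p‖ ^ 2 + inner ℝ (z - p) g + α * ‖g‖ ^ 2 / 2 := by field_simp
  have e₃ : α ^ 2 * ‖g‖ ^ 2 / (2 * α) = α * ‖g‖ ^ 2 / 2 := by field_simp
  rw [e₁] at hz
  rw [e₂, e₃]
  linarith

theorem mul_norm_sq_le_norm_add_sq_div {E : Type*} [NormedAddCommGroup E] [InnerProductSpace ℝ E]
    {μ : ℝ} (hμ : 0 < μ) {g : E} (hg : ‖g‖ ≤ 1) (q : E) :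
    μ * ‖g‖ ^ 2 / 2 ≤ ‖q‖ + ‖μ • g - q‖ ^ 2 / (2 * μ) := by
  have hin : inner ℝ g q ≤ ‖q‖ :=
    (real_inner_le_norm g q).trans (mul_le_of_le_one_left (norm_nonneg q) hg)
  rw [norm_sub_sq_real, inner_smul_left, norm_smul, mul_pow, Real.norm_eq_abs, sq_abs]
  have e : (μ ^ 2 * ‖g‖ ^ 2 - 2 * (μ * inner ℝ g q) + ‖q‖ ^ 2) / (2 * μ) =
      μ * ‖g‖ ^ 2 / 2 - inner ℝ g q + ‖q‖ ^ 2 / (2 * μ) := by field_simp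
  have : 0 ≤ ‖q‖ ^ 2 / (2 * μ) := by positivity
  simp only [conj_trivial]
  rw [e]
  linarith

theorem norm_sub_half_le_norm_add_sq_div {E : Type*} [NormedAddCommGroup E]
    {μ : ℝ} (hμ : 0 < μ) (w q : E) :
    ‖w‖ - μ / 2 ≤ ‖q‖ + ‖w - q‖ ^ 2 / (2 * μ) := by
  have h : ‖w - q‖ - μ / 2 ≤ ‖w - q‖ ^ 2 / (2 * μ) := by
    rw [le_div_iff₀ (by positivity)]
    nlinarith [sq_nonneg (‖w - q‖ - μ)]
  linarith [norm_sub_norm_le w q]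

theorem neg_moreauEnv_add_sq_growth_proxNegMoreau (n : ℕ) (a : EuclideanSpace ℝ (Fin n))
    (d : ℝ) {μ α : ℝ} (hμ : 0 < μ) (hα : 0 < α) (hαμ : α < μ) (c z : EuclideanSpace ℝ (Fin n)) :
    -moreauEnv n a d μ (proxNegMoreau n a μ α c) +
        ‖proxNegMoreau n a μ α c - c‖ ^ 2 / (2 * α) +
        (1 / α - 1 / μ) / 2 * ‖z - proxNegMoreau n a μ α c‖ ^ 2 ≤
      -moreauEnv n a d μ z + ‖z - c‖ ^ 2 / (2 * α) := by
  have hδ : 0 < μ - α := sub_pos.2 hαμ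
  unfold proxNegMoreau
  split_ifs with h
  · refine neg_moreauEnv_add_sq_quadratic_growth (g := (μ - α)⁻¹ • (c - a)) hμ hα ?_ (fun y => ?_) z
    · match_scalars <;> field_simp <;> ring
    · have hg : ‖(μ - α)⁻¹ • (c - a)‖ ≤ 1 := by
        rw [norm_smul, Real.norm_of_nonneg (by positivity), inv_mul_le_iff₀ hδ, mul_one]
        exact h
      convert mul_norm_sq_le_norm_add_sq_div hμ hg (y - a) using 3
      · rw [add_eq_right, norm_eq_zero]
        match_scalars <;> field_simp <;> ring
      · congr 2
        match_scalars <;> field_simp <;> ring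
  · push Not at h
    have hs : 0 < ‖c - a‖ := hδ.trans h
    refine neg_moreauEnv_add_sq_quadratic_growth (g := ‖c - a‖⁻¹ • (c - a)) hμ hα ?_ (fun y => ?_) z
    · match_scalars <;> field_simp <;> ring
    · have hnorm (t : ℝ) (ht : 0 ≤ t) : ‖(t / ‖c - a‖) • (c - a)‖ = t := by
        rw [norm_smul, Real.norm_of_nonneg (by positivity), div_mul_cancel₀ _ hs.ne']
      have hg : ‖‖c - a‖⁻¹ • (c - a)‖ = 1 := by
        simpa only [one_div] using hnorm 1 zero_le_one
      have hy : a + ((‖c - a‖ + α) / ‖c - a‖) • (c - a) - μ • ‖c - a‖⁻¹ • (c - a) - a =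
          ((‖c - a‖ + α - μ) / ‖c - a‖) • (c - a) := by
        match_scalars <;> field_simp <;> ring
      have key := norm_sub_half_le_norm_add_sq_div hμ
        (((‖c - a‖ + α) / ‖c - a‖) • (c - a)) (y - a)
      rw [hnorm _ (by positivity)] at key
      have hw : a + ((‖c - a‖ + α) / ‖c - a‖) • (c - a) - y =
          ((‖c - a‖ + α) / ‖c - a‖) • (c - a) - (y - a) := by abel
      rw [hy, hnorm _ (by linarith), hg, hw]
      linarith

/-- Let μ > 0 and 0 < α < μ. For every c ∈ ℝⁿ, the function
z ↦ −e_φ(z, μ) + ‖z − c‖²/(2α) has a unique minimizer over ℝⁿ, equal to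
a + (μ/(μ − α))·(c − a) if ‖c − a‖ ≤ μ − α, and to
a + ((‖c − a‖ + α)/‖c − a‖)·(c − a) if ‖c − a‖ > μ − α. -/
theorem prox_neg_moreau_formula (n : ℕ) (a : EuclideanSpace ℝ (Fin n)) (d μ α : ℝ)
    (hμ : 0 < μ) (hα : 0 < α) (hαμ : α < μ) (c : EuclideanSpace ℝ (Fin n)) :
    IsMinOn
      (fun z : EuclideanSpace ℝ (Fin n) =>
        -moreauEnv n a d μ z + ‖z - c‖ ^ 2 / (2 * α)) Set.univ
      (proxNegMoreau n a μ α c) ∧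
    (∀ z : EuclideanSpace ℝ (Fin n),
      IsMinOn
        (fun z : EuclideanSpace ℝ (Fin n) =>
          -moreauEnv n a d μ z + ‖z - c‖ ^ 2 / (2 * α)) Set.univ z →
      z = proxNegMoreau n a μ α c) := by
  have growth := neg_moreauEnv_add_sq_growth_proxNegMoreau n a d hμ hα hαμ c
  have hκ : 0 < (1 / α - 1 / μ) / 2 :=
    half_pos (sub_pos.2 (one_div_lt_one_div_of_lt hα hαμ))
  refine ⟨fun z _ => ?_, fun z hz => ?_⟩
  · have : 0 ≤ (1 / α - 1 / μ) / 2 * ‖z - proxNegMoreau n a μ α c‖ ^ 2 := by positivity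
    exact (le_add_of_nonneg_right this).trans (growth z)
  · have hle := (growth z).trans (hz (Set.mem_univ (proxNegMoreau n a μ α c)))
    rw [add_le_iff_nonpos_right] at hle
    have hsq : ‖z - proxNegMoreau n a μ α c‖ ^ 2 ≤ 0 := nonpos_of_mul_nonpos_right hle hκ
    exact sub_eq_zero.1 (norm_eq_zero.1 (pow_eq_zero_iff two_ne_zero |>.1
      (le_antisymm hsq (sq_nonneg _))))
end

section
/- Let d > 0 and λ > 0. For every p ∈ ℝⁿ, the function x ↦ 2·max(0, ‖x − a‖ − d) + ‖x − p‖²/(2λ) has a unique minimizer over ℝⁿ, equal to: p if ‖p − a‖ ≤ d; a + d·(p − a)/‖p − a‖ if d < ‖p − a‖ ≤ d + 2λ; and p − 2λ·(p − a)/‖p − a‖ if ‖p − a‖ > d + 2λ. -/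
/-- The claimed proximal point of Γ(x) = 2·max(0, ‖x − a‖ − d) with step λ at p. -/
noncomputable def proxGamma (n : ℕ) (a : EuclideanSpace ℝ (Fin n)) (d lam : ℝ)
    (p : EuclideanSpace ℝ (Fin n)) : EuclideanSpace ℝ (Fin n) :=
  if ‖p - a‖ ≤ d then p
  else if ‖p - a‖ ≤ d + 2 * lam then a + (d / ‖p - a‖) • (p - a)
  else p - ((2 * lam) / ‖p - a‖) • (p - a)

/-- If `λ⁻¹ • (p - q)` is a subgradient of `g` at `q`, then `q` minimizes
`x ↦ g x + ‖x - p‖ ^ 2 / (2 * λ)` with quadratic growth. -/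
lemma prox_quadratic_growth {E : Type*} [NormedAddCommGroup E] [InnerProductSpace ℝ E]
    {g : E → ℝ} {lam : ℝ} (hlam : 0 < lam) {p q x : E}
    (hsub : g q + inner ℝ (p - q) (x - q) / lam ≤ g x) :
    g q + ‖q - p‖ ^ 2 / (2 * lam) + ‖x - q‖ ^ 2 / (2 * lam) ≤
      g x + ‖x - p‖ ^ 2 / (2 * lam) := by
  have hsq : ‖x - p‖ ^ 2 = ‖x - q‖ ^ 2 - 2 * inner ℝ (p - q) (x - q) + ‖q - p‖ ^ 2 := by
    rw [← sub_sub_sub_cancel_right x p q, norm_sub_sq_real, real_inner_comm, norm_sub_rev p q]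
  have hdiv : ‖x - p‖ ^ 2 / (2 * lam) = ‖x - q‖ ^ 2 / (2 * lam)
      - inner ℝ (p - q) (x - q) / lam + ‖q - p‖ ^ 2 / (2 * lam) := by
    rw [hsq]
    field_simp
  linarith

/-- A scalar subgradient inequality for a radial function gives one at the point
`a + c • (p - a)` of the segment from `a` to `p`. -/
lemma radial_subgradient {E : Type*} [NormedAddCommGroup E] [InnerProductSpace ℝ E]
    {φ : ℝ → ℝ} {lam c : ℝ} (hlam : 0 < lam) {a p q : E}
    (hc₀ : 0 ≤ c) (hc₁ : c ≤ 1) (hq : q = a + c • (p - a))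
    (hφ : ∀ s, φ (c * ‖p - a‖) + (1 - c) * ‖p - a‖ * (s - c * ‖p - a‖) / lam ≤ φ s) (x : E) :
    φ ‖q - a‖ + inner ℝ (p - q) (x - q) / lam ≤ φ ‖x - a‖ := by
  have hqa : ‖q - a‖ = c * ‖p - a‖ := by
    rw [hq, add_sub_cancel_left, norm_smul, Real.norm_of_nonneg hc₀]
  have hpq : p - q = (1 - c) • (p - a) := by rw [hq]; module
  have hxq : x - q = (x - a) - c • (p - a) := by rw [hq]; module
  have hinner : inner ℝ (p - q) (x - q) ≤
      (1 - c) * ‖p - a‖ * (‖x - a‖ - c * ‖p - a‖) := by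
    rw [hpq, hxq, real_inner_smul_left, inner_sub_right, real_inner_smul_right,
      real_inner_self_eq_norm_sq, mul_assoc]
    refine mul_le_mul_of_nonneg_left ?_ (sub_nonneg.2 hc₁)
    linarith [real_inner_le_norm (p - a) (x - a)]
  rw [hqa]
  exact (add_le_add_right (div_le_div_of_nonneg_right hinner hlam.le) _).trans (hφ _)

lemma proxGamma_subgradient (n : ℕ) (a : EuclideanSpace ℝ (Fin n)) {d lam : ℝ}
    (hd : 0 < d) (hlam : 0 < lam) (p x : EuclideanSpace ℝ (Fin n)) :
    2 * max 0 (‖proxGamma n a d lam p - a‖ - d) +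
      inner ℝ (p - proxGamma n a d lam p) (x - proxGamma n a d lam p) / lam ≤
        2 * max 0 (‖x - a‖ - d) := by
  unfold proxGamma
  split_ifs with h₁ h₂
  · simp [h₁]
  · push Not at h₁
    have hr : 0 < ‖p - a‖ := hd.trans h₁
    refine radial_subgradient (φ := fun s => 2 * max 0 (s - d)) hlam (by positivity)
      ((div_le_one hr).2 h₁.le) rfl (fun s => ?_) x
    have hcr : d / ‖p - a‖ * ‖p - a‖ = d := div_mul_cancel₀ _ hr.ne'
    rw [sub_mul, hcr, one_mul, sub_self, max_self, mul_zero, zero_add, div_le_iff₀ hlam]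
    rcases le_total s d with hs | hs
    · rw [max_eq_left (by linarith)]
      nlinarith
    · rw [max_eq_right (by linarith)]
      nlinarith
  · push Not at h₁ h₂
    have hr : 0 < ‖p - a‖ := hd.trans h₁
    have hcr : 2 * lam / ‖p - a‖ * ‖p - a‖ = 2 * lam := div_mul_cancel₀ _ hr.ne'
    refine radial_subgradient (φ := fun s => 2 * max 0 (s - d))
      (c := 1 - 2 * lam / ‖p - a‖) hlam
      (sub_nonneg.2 ((div_le_one hr).2 (by linarith))) (sub_le_self _ (by positivity))
      (by module) (fun s => ?_) x
    rw [sub_sub_cancel, sub_mul, hcr, one_mul, max_eq_right (by linarith),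
      mul_right_comm, mul_div_cancel_right₀ _ hlam.ne']
    linarith [le_max_right 0 (s - d)]

/-- Let d > 0 and λ > 0. For every p ∈ ℝⁿ, the function
x ↦ 2·max(0, ‖x − a‖ − d) + ‖x − p‖²/(2λ) has a unique minimizer over ℝⁿ, equal to:
p if ‖p − a‖ ≤ d; a + d·(p − a)/‖p − a‖ if d < ‖p − a‖ ≤ d + 2λ; and
p − 2λ·(p − a)/‖p − a‖ if ‖p − a‖ > d + 2λ. -/
theorem prox_gamma_formula (n : ℕ) (a : EuclideanSpace ℝ (Fin n)) (d lam : ℝ)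
    (hd : 0 < d) (hlam : 0 < lam) (p : EuclideanSpace ℝ (Fin n)) :
    IsMinOn
      (fun x : EuclideanSpace ℝ (Fin n) =>
        2 * max 0 (‖x - a‖ - d) + ‖x - p‖ ^ 2 / (2 * lam)) Set.univ
      (proxGamma n a d lam p) ∧
    (∀ x : EuclideanSpace ℝ (Fin n),
      IsMinOn
        (fun x : EuclideanSpace ℝ (Fin n) =>
          2 * max 0 (‖x - a‖ - d) + ‖x - p‖ ^ 2 / (2 * lam)) Set.univ x →
      x = proxGamma n a d lam p) := by
  have growth := fun x => prox_quadratic_growth (g := fun x => 2 * max 0 (‖x - a‖ - d)) hlam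
    (proxGamma_subgradient n a hd hlam p x)
  refine ⟨fun x _ => ?_, fun x hx => ?_⟩
  · exact (le_add_of_nonneg_right (by positivity)).trans (growth x)
  · have hmin := hx (Set.mem_univ (proxGamma n a d lam p))
    have hle : ‖x - proxGamma n a d lam p‖ ^ 2 / (2 * lam) ≤ 0 := by
      have hgrow := growth x
      simp only [Set.mem_ofPred_eq] at hmin hgrow
      linarith
    rw [div_le_iff₀ (by positivity), zero_mul] at hle
    exact sub_eq_zero.1 (norm_eq_zero.1 (pow_eq_zero_iff two_ne_zero |>.1
      (le_antisymm hle (sq_nonneg _))))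
end

section
/- Fix μ > 0, ω > 0, σ > 0 and u, v ∈ ℝ. The function (g, q) ↦ ω·f(g − q, μ) + (σ/2)((g − u)² + (q − v)²) attains its minimum over ℝ² at the unique point g* = (u + v)/2 − s*/2, q* = (u + v)/2 + s*/2, where s* is the unique minimizer of s ↦ (2ω/σ)·f(s, μ) + (s − (v − u))²/2 (i.e., s* = prox_{(2ω/σ) f(·,μ)}(v − u)). -/
theorem huber_neg (μ z : ℝ) : huber μ (-z) = huber μ z := by
  simp [huber]

/-- In the coordinates `q - g` and `g + q` the joint objective splits into the scalar proximal
objective plus a square. -/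
theorem joint_objective_eq (μ ω u v g q : ℝ) {σ : ℝ} (hσ : σ ≠ 0) :
    ω * huber μ (g - q) + (σ / 2) * ((g - u) ^ 2 + (q - v) ^ 2) =
      (σ / 2) * (((2 * ω / σ) * huber μ (q - g) + ((q - g) - (v - u)) ^ 2 / 2) +
        (g + q - (u + v)) ^ 2 / 2) := by
  rw [← neg_sub q g, huber_neg]
  field_simp
  ring

/-- Fix μ > 0, ω > 0, σ > 0 and u, v ∈ ℝ. The function
(g, q) ↦ ω·f(g − q, μ) + (σ/2)((g − u)² + (q − v)²) attains its minimum over ℝ² at the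
unique point g* = (u + v)/2 − s*/2, q* = (u + v)/2 + s*/2, where s* is the unique
minimizer of s ↦ (2ω/σ)·f(s, μ) + (s − (v − u))²/2. -/
theorem joint_gq_update (μ ω σ u v s : ℝ) (hμ : 0 < μ) (hω : 0 < ω) (hσ : 0 < σ)
    (hs_min : IsMinOn (fun s : ℝ => (2 * ω / σ) * huber μ s + (s - (v - u)) ^ 2 / 2)
      Set.univ s)
    (hs_uniq : ∀ s' : ℝ,
      IsMinOn (fun s : ℝ => (2 * ω / σ) * huber μ s + (s - (v - u)) ^ 2 / 2)
        Set.univ s' → s' = s) :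
    IsMinOn
      (fun p : ℝ × ℝ =>
        ω * huber μ (p.1 - p.2) + (σ / 2) * ((p.1 - u) ^ 2 + (p.2 - v) ^ 2)) Set.univ
      ((u + v) / 2 - s / 2, (u + v) / 2 + s / 2) ∧
    (∀ p : ℝ × ℝ,
      IsMinOn
        (fun p : ℝ × ℝ =>
          ω * huber μ (p.1 - p.2) + (σ / 2) * ((p.1 - u) ^ 2 + (p.2 - v) ^ 2)) Set.univ
        p →
      p = ((u + v) / 2 - s / 2, (u + v) / 2 + s / 2)) := by
  simp only [joint_objective_eq μ ω u v _ _ hσ.ne', isMinOn_univ_iff, Prod.forall,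
    mul_le_mul_iff_right₀ (half_pos hσ)] at *
  have hdiff (t : ℝ) : (u + v) / 2 + t / 2 - ((u + v) / 2 - t / 2) = t := by ring
  have hsum (t : ℝ) : (u + v) / 2 - t / 2 + ((u + v) / 2 + t / 2) - (u + v) = 0 := by ring
  refine ⟨fun g q => ?_, fun g q h => ?_⟩
  · rw [hdiff, hsum]
    linarith [hs_min (q - g), sq_nonneg (g + q - (u + v))]
  · have hle (t : ℝ) := h ((u + v) / 2 - t / 2) ((u + v) / 2 + t / 2)
    simp only [hdiff, hsum] at hle
    have hqg : q - g = s :=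
      hs_uniq _ fun t => by linarith [hle t, sq_nonneg (g + q - (u + v))]
    have hgq : g + q - (u + v) = 0 :=
      pow_eq_zero_iff two_ne_zero |>.mp <|
        le_antisymm (by linarith [hle (q - g)]) (sq_nonneg _)
    ext <;> dsimp only <;> linarith
end
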